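/- arXiv:1501.07458 — 2 statements merged into one kernel-verified Lean document; each statement's English description precedes it below -/
import Mathlib

section
/- Let F be a distribution on ℝ such that the n-fold convolution F^{*n} is long-tailed for some n ≥ 1. Then F^{*k} is long-tailed for every k ≥ n. -/
open MeasureTheory Filter Set Asymptotics

/-- Tail function of a distribution: `F̄(x) = μ(x, ∞)`. -/
noncomputable def tail (μ : Measure ℝ) (x : ℝ) : ℝ := (μ (Set.Ioi x)).toReal

/-- `F(a, b] = F(b) - F(a)`. -/
noncomputable def intv (μ : Measure ℝ) (a b : ℝ) : ℝ := (μ (Set.Ioc a b)).toReal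

/-- A distribution is long-tailed if `F̄(x+1)/F̄(x) → 1` as `x → ∞`. -/
def LongTailed (μ : Measure ℝ) : Prop :=
  Tendsto (fun x => tail μ (x + 1) / tail μ x) atTop (nhds 1)

/-- Convolution of two distributions on ℝ (law of the sum of independent rvs). -/
noncomputable def mconv (μ ν : Measure ℝ) : Measure ℝ :=
  Measure.map (fun p : ℝ × ℝ => p.1 + p.2) (μ.prod ν)

/-- `n`-fold convolution of a distribution with itself; `nconv μ 0` is the unit mass at 0. -/
noncomputable def nconv (μ : Measure ℝ) : ℕ → Measure ℝ
  | 0 => Measure.dirac 0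
  | n + 1 => mconv (nconv μ n) μ

open scoped NNReal ENNReal

/-- The mass of unit intervals `(x, x + 1]` is negligible compared with the tail at `x`. -/
def UnitIntervalNegligible (μ : Measure ℝ) : Prop :=
  ∀ ε : ℝ≥0, 0 < ε → ∀ᶠ x in atTop, μ (Ioc x (x + 1)) ≤ ε * μ (Ioi x)

lemma tail_eq_intv_add_tail (μ : Measure ℝ) [IsFiniteMeasure μ] (x : ℝ) :
    tail μ x = intv μ x (x + 1) + tail μ (x + 1) := by
  unfold tail intv
  rw [← ENNReal.toReal_add (measure_ne_top _ _) (measure_ne_top _ _),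
    ← measure_union (Ioc_disjoint_Ioi le_rfl) measurableSet_Ioi,
    Ioc_union_Ioi_eq_Ioi (by linarith)]

lemma measure_Ioc_le_mul_iff (μ : Measure ℝ) [IsFiniteMeasure μ] (ε : ℝ≥0) (x : ℝ) :
    μ (Ioc x (x + 1)) ≤ ε * μ (Ioi x) ↔ intv μ x (x + 1) ≤ ε * tail μ x := by
  unfold tail intv
  rw [← ENNReal.toReal_le_toReal (measure_ne_top _ _)
    (ENNReal.mul_ne_top ENNReal.coe_ne_top (measure_ne_top _ _)), ENNReal.toReal_mul,
    ENNReal.coe_toReal]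

lemma LongTailed.measure_Ioi_ne_zero {μ : Measure ℝ} (h : LongTailed μ) (x : ℝ) :
    μ (Ioi x) ≠ 0 := by
  intro h0
  have hev : ∀ᶠ y in atTop, tail μ (y + 1) / tail μ y = 0 := by
    filter_upwards [eventually_ge_atTop x] with y hy
    have : μ (Ioi y) = 0 := measure_mono_null (Ioi_subset_Ioi hy) h0
    simp [tail, this]
  exact zero_ne_one (tendsto_nhds_unique (tendsto_const_nhds.congr' (hev.mono fun _ h => h.symm)) h)

lemma tail_pos {μ : Measure ℝ} [IsFiniteMeasure μ] {x : ℝ} (h : μ (Ioi x) ≠ 0) : 0 < tail μ x :=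
  ENNReal.toReal_pos h (measure_ne_top _ _)

lemma LongTailed.unitIntervalNegligible {μ : Measure ℝ} [IsFiniteMeasure μ] (h : LongTailed μ) :
    UnitIntervalNegligible μ := by
  intro ε hε
  have hε' : (0 : ℝ) < ε := hε
  filter_upwards [h.eventually_const_lt (show (1 : ℝ) - ε < 1 by linarith)] with x hx
  rw [measure_Ioc_le_mul_iff]
  rw [lt_div_iff₀ (tail_pos (h.measure_Ioi_ne_zero x))] at hx
  linarith [tail_eq_intv_add_tail μ x]

lemma UnitIntervalNegligible.longTailed {μ : Measure ℝ} [IsFiniteMeasure μ]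
    (h : UnitIntervalNegligible μ) (hpos : ∀ x, μ (Ioi x) ≠ 0) : LongTailed μ := by
  refine tendsto_order.2 ⟨fun a ha => ?_, fun a ha => Eventually.of_forall fun x => ?_⟩
  · have hε : 0 < (1 - a) / 2 := by linarith
    filter_upwards [h _ (Real.toNNReal_pos.2 hε)] with x hx
    rw [measure_Ioc_le_mul_iff, Real.coe_toNNReal _ hε.le] at hx
    have hx0 := tail_pos (hpos x)
    rw [lt_div_iff₀ hx0]
    nlinarith [tail_eq_intv_add_tail μ x]
  · refine lt_of_le_of_lt ?_ ha
    rw [div_le_one (tail_pos (hpos x)), tail_eq_intv_add_tail μ x]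
    exact le_add_of_nonneg_left ENNReal.toReal_nonneg

lemma UnitIntervalNegligible.measure_Ioi_le {μ : Measure ℝ} [IsFiniteMeasure μ]
    (h : UnitIntervalNegligible μ) (k : ℕ) :
    ∀ᶠ x in atTop, μ (Ioi x) ≤ 2 ^ k * μ (Ioi (x + k)) := by
  induction k with
  | zero => simp
  | succ k ih =>
    have hs : ∀ᶠ x in atTop, μ (Ioi x) ≤ 2 * μ (Ioi (x + 1)) := by
      filter_upwards [h (1 / 2) (by norm_num)] with x hx
      rw [measure_Ioc_le_mul_iff] at hx
      have hx' : tail μ x ≤ 2 * tail μ (x + 1) := by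
        push_cast at hx
        linarith [tail_eq_intv_add_tail μ x]
      unfold tail at hx'
      rwa [← ENNReal.toReal_le_toReal (measure_ne_top _ _)
        (ENNReal.mul_ne_top (by simp) (measure_ne_top _ _)), ENNReal.toReal_mul,
        ENNReal.toReal_ofNat]
    filter_upwards [ih, (tendsto_atTop_add_const_right _ (k : ℝ) tendsto_id).eventually hs]
      with x hx hx1
    calc μ (Ioi x) ≤ 2 ^ k * μ (Ioi (x + k)) := hx
      _ ≤ 2 ^ k * (2 * μ (Ioi (x + k + 1))) := by gcongr; exact hx1
      _ = 2 ^ (k + 1) * μ (Ioi (x + (k + 1 : ℕ))) := by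
        push_cast
        rw [pow_succ, mul_assoc, add_assoc]

lemma UnitIntervalNegligible.measure_Ioc_nat_le {μ : Measure ℝ}
    (h : UnitIntervalNegligible μ) (k : ℕ) :
    ∀ ε : ℝ≥0, 0 < ε → ∀ᶠ x in atTop, μ (Ioc x (x + k)) ≤ ε * μ (Ioi x) := by
  induction k with
  | zero => simp
  | succ k ih =>
    intro ε hε
    have h2 : 0 < ε / 2 := by positivity
    filter_upwards [ih _ h2,
      (tendsto_atTop_add_const_right _ (k : ℝ) tendsto_id).eventually (h _ h2)] with x hx hx1
    simp only [id] at hx1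
    have hk : (0 : ℝ) ≤ k := k.cast_nonneg
    calc μ (Ioc x (x + (k + 1 : ℕ)))
        ≤ μ (Ioc x (x + k) ∪ Ioc (x + k) (x + k + 1)) := by
          rw [Ioc_union_Ioc_eq_Ioc (by linarith) (by linarith)]
          push_cast
          rw [add_assoc]
      _ ≤ μ (Ioc x (x + k)) + μ (Ioc (x + k) (x + k + 1)) := measure_union_le _ _
      _ ≤ (ε / 2 : ℝ≥0) * μ (Ioi x) + (ε / 2 : ℝ≥0) * μ (Ioi (x + k)) := add_le_add hx hx1
      _ ≤ (ε / 2 : ℝ≥0) * μ (Ioi x) + (ε / 2 : ℝ≥0) * μ (Ioi x) := by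
          gcongr
          linarith
      _ = ε * μ (Ioi x) := by
          rw [← add_mul, ← ENNReal.coe_add, add_halves]

lemma mconv_apply (μ ν : Measure ℝ) {s : Set ℝ} (hs : MeasurableSet s) :
    mconv μ ν s = (μ.prod ν) ((fun p : ℝ × ℝ => p.1 + p.2) ⁻¹' s) :=
  Measure.map_apply (by fun_prop) hs

instance isProbabilityMeasure_mconv (μ ν : Measure ℝ) [IsProbabilityMeasure μ]
    [IsProbabilityMeasure ν] : IsProbabilityMeasure (mconv μ ν) :=
  Measure.isProbabilityMeasure_map (by fun_prop)

instance isProbabilityMeasure_nconv (μ : Measure ℝ) [IsProbabilityMeasure μ] (n : ℕ) :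
    IsProbabilityMeasure (nconv μ n) := by
  induction n with
  | zero => exact Measure.dirac.isProbabilityMeasure
  | succ n ih => exact isProbabilityMeasure_mconv _ _

lemma mul_le_mconv {μ ν : Measure ℝ} [SFinite ν] {s t u : Set ℝ} (hu : MeasurableSet u)
    (h : ∀ a ∈ s, ∀ b ∈ t, a + b ∈ u) : μ s * ν t ≤ mconv μ ν u := by
  rw [mconv_apply _ _ hu, ← Measure.prod_prod]
  exact measure_mono fun p hp => h _ hp.1 _ hp.2

lemma exists_nat_measure_Ioc_ne_zero (μ : Measure ℝ) [NeZero μ] :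
    ∃ N : ℕ, μ (Ioc (-N : ℝ) N) ≠ 0 := by
  by_contra! h
  have hU : (⋃ N : ℕ, Ioc (-N : ℝ) N) = univ := by
    refine eq_univ_of_forall fun x => ?_
    obtain ⟨N, hN⟩ := exists_nat_gt |x|
    exact mem_iUnion.2 ⟨N, (abs_lt.1 hN).1, (abs_lt.1 hN).2.le⟩
  exact NeZero.ne μ (Measure.measure_univ_eq_zero.1 (hU ▸ measure_iUnion_null h))

/-- Unit intervals of a convolution factor are negligible compared with a shifted tail of the
convolution. -/
lemma UnitIntervalNegligible.exists_shift {μ ν : Measure ℝ} [IsProbabilityMeasure μ]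
    [IsProbabilityMeasure ν] (h : UnitIntervalNegligible (mconv μ ν)) :
    ∃ N : ℕ, ∀ ε : ℝ≥0, 0 < ε →
      ∀ᶠ x in atTop, ν (Ioc x (x + 1)) ≤ ε * mconv μ ν (Ioi (x - N)) := by
  obtain ⟨N, hN⟩ := exists_nat_measure_Ioc_ne_zero μ
  refine ⟨N, fun ε hε => ?_⟩
  obtain ⟨c, hc⟩ : ∃ c : ℝ≥0, (c : ℝ≥0∞) = _ :=
    ⟨_, ENNReal.coe_toNNReal (measure_ne_top μ (Ioc (-N : ℝ) N))⟩
  rw [← hc] at hN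
  have hc0 : 0 < c := pos_iff_ne_zero.2 (by exact_mod_cast hN)
  filter_upwards [(tendsto_atTop_add_const_right _ (-N : ℝ) tendsto_id).eventually
    (h.measure_Ioc_nat_le (2 * N + 1) (c * ε) (by positivity))] with x hx
  simp only [id, ← sub_eq_add_neg] at hx
  have hle : (c : ℝ≥0∞) * ν (Ioc x (x + 1)) ≤
      mconv μ ν (Ioc (x - N) (x - N + (2 * N + 1 : ℕ))) := by
    rw [hc]
    refine mul_le_mconv measurableSet_Ioc fun a ha b hb => ?_
    push_cast
    exact ⟨by linarith [ha.1, hb.1], by linarith [ha.2, hb.2]⟩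
  have := hle.trans hx
  rw [ENNReal.coe_mul, mul_assoc] at this
  exact (ENNReal.mul_le_mul_iff_right hN ENNReal.coe_ne_top).1 this

lemma UnitIntervalNegligible.exists_measure_Ioi_le_mul_mconv {μ ν : Measure ℝ}
    [IsProbabilityMeasure μ] [IsProbabilityMeasure ν] (h : UnitIntervalNegligible μ) (a : ℝ) :
    ∃ C : ℝ≥0, 0 < C ∧ ∀ᶠ x in atTop, μ (Ioi (x - a)) ≤ C * mconv μ ν (Ioi x) := by
  obtain ⟨M, hM⟩ := exists_nat_measure_Ioc_ne_zero ν
  obtain ⟨c, hc⟩ : ∃ c : ℝ≥0, (c : ℝ≥0∞) = _ :=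
    ⟨_, ENNReal.coe_toNNReal (measure_ne_top ν (Ioc (-M : ℝ) M))⟩
  rw [← hc] at hM
  have hc0 : 0 < c := pos_iff_ne_zero.2 (by exact_mod_cast hM)
  obtain ⟨k, hk⟩ := exists_nat_ge (a + M)
  refine ⟨2 ^ k / c, by positivity, ?_⟩
  filter_upwards [(tendsto_atTop_add_const_right _ (-a) tendsto_id).eventually
    (h.measure_Ioi_le k)] with x hx
  simp only [id, ← sub_eq_add_neg] at hx
  have hle : μ (Ioi (x - a + k)) * c ≤ mconv μ ν (Ioi x) := by
    rw [hc]
    refine mul_le_mconv measurableSet_Ioi fun u hu b hb => ?_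
    have hu' : x - a + k < u := hu
    show x < u + b
    linarith [hb.1]
  calc μ (Ioi (x - a)) ≤ 2 ^ k * μ (Ioi (x - a + k)) := hx
    _ = (2 ^ k / c : ℝ≥0) * (μ (Ioi (x - a + k)) * c) := by
      rw [mul_comm (μ _), ← mul_assoc, ← ENNReal.coe_mul, div_mul_cancel₀ _ hc0.ne']
      simp
    _ ≤ _ := by gcongr

/-- The contribution to a unit interval of a convolution from large first summands. -/
lemma prod_large_le {μ ν : Measure ℝ} [SFinite μ] [SFinite ν] {A : ℝ} {ε : ℝ≥0}
    (hA : ∀ y, A ≤ y → μ (Ioc y (y + 1)) ≤ ε * μ (Ioi y)) (x : ℝ) :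
    (μ.prod ν) {p | p.1 + p.2 ∈ Ioc x (x + 1) ∧ A < p.1} ≤ ε * mconv μ ν (Ioi x) := by
  have hm : MeasurableSet {p : ℝ × ℝ | p.1 + p.2 ∈ Ioc x (x + 1) ∧ A < p.1} :=
    ((measurable_fst.add measurable_snd) measurableSet_Ioc).inter
      (measurable_fst measurableSet_Ioi)
  have hm' : MeasurableSet ((fun p : ℝ × ℝ => p.1 + p.2) ⁻¹' Ioi x) :=
    (measurable_fst.add measurable_snd) measurableSet_Ioi
  rw [mconv_apply _ _ measurableSet_Ioi, Measure.prod_apply_symm hm, Measure.prod_apply_symm hm',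
    ← lintegral_const_mul' _ _ ENNReal.coe_ne_top]
  refine lintegral_mono fun y => ?_
  calc μ ((fun u => (u, y)) ⁻¹' {p : ℝ × ℝ | p.1 + p.2 ∈ Ioc x (x + 1) ∧ A < p.1})
      ≤ μ (Ioc (max A (x - y)) (max A (x - y) + 1)) := by
        refine measure_mono fun u hu => ?_
        obtain ⟨⟨h1, h2⟩, h3⟩ := hu
        simp only at h1 h2 h3
        exact ⟨max_lt h3 (by linarith), by linarith [le_max_right A (x - y)]⟩
    _ ≤ ε * μ (Ioi (max A (x - y))) := hA _ (le_max_left _ _)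
    _ ≤ _ := by
        gcongr
        intro u hu
        have := (le_max_right A (x - y)).trans_lt hu
        show x < u + y
        linarith

/-- The contribution to a unit interval of a convolution from small first summands. -/
lemma prod_small_le {μ ν : Measure ℝ} [IsProbabilityMeasure μ] [SFinite ν] {A x : ℝ} {B : ℝ≥0∞}
    (hB : ∀ y, x - A ≤ y → ν (Ioc y (y + 1)) ≤ B) :
    (μ.prod ν) {p | p.1 + p.2 ∈ Ioc x (x + 1) ∧ p.1 ≤ A} ≤ B := by
  have hm : MeasurableSet {p : ℝ × ℝ | p.1 + p.2 ∈ Ioc x (x + 1) ∧ p.1 ≤ A} :=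
    ((measurable_fst.add measurable_snd) measurableSet_Ioc).inter
      (measurable_fst measurableSet_Iic)
  rw [Measure.prod_apply hm]
  calc _ ≤ ∫⁻ _, B ∂μ := by
        refine lintegral_mono fun u => ?_
        by_cases hu : u ≤ A
        · refine (measure_mono fun y hy => ?_).trans (hB (x - u) (by linarith))
          obtain ⟨⟨h1, h2⟩, -⟩ := hy
          simp only at h1 h2
          exact ⟨by linarith, by linarith⟩
        · simp [hu]
    _ = B := by simp

lemma UnitIntervalNegligible.mconv {μ ν : Measure ℝ} [IsProbabilityMeasure μ]
    [IsProbabilityMeasure ν] (h : UnitIntervalNegligible μ) {N : ℕ}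
    (hν : ∀ ε : ℝ≥0, 0 < ε → ∀ᶠ x in atTop, ν (Ioc x (x + 1)) ≤ ε * μ (Ioi (x - N))) :
    UnitIntervalNegligible (mconv μ ν) := by
  intro ε hε
  obtain ⟨A, hA⟩ := eventually_atTop.1 (h (ε / 2) (by positivity))
  obtain ⟨C, hC, hCx⟩ := h.exists_measure_Ioi_le_mul_mconv (ν := ν) (A + N)
  obtain ⟨B, hB⟩ := eventually_atTop.1 (hν (ε / 2 / C) (by positivity))
  filter_upwards [hCx, eventually_ge_atTop (A + B)] with x hx hxB
  have hsmall : (μ.prod ν) {p | p.1 + p.2 ∈ Ioc x (x + 1) ∧ p.1 ≤ A} ≤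
      (ε / 2 / C : ℝ≥0) * μ (Ioi (x - (A + N))) := by
    refine prod_small_le fun y hy => (hB y (by linarith)).trans ?_
    exact mul_le_mul_right (measure_mono (Ioi_subset_Ioi (by linarith))) _
  calc _root_.mconv μ ν (Ioc x (x + 1))
      ≤ (μ.prod ν) ({p | p.1 + p.2 ∈ Ioc x (x + 1) ∧ A < p.1} ∪
          {p | p.1 + p.2 ∈ Ioc x (x + 1) ∧ p.1 ≤ A}) := by
        rw [mconv_apply _ _ measurableSet_Ioc]
        exact measure_mono fun p hp => (lt_or_ge A p.1).imp (⟨hp, ·⟩) (⟨hp, ·⟩)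
    _ ≤ _ := measure_union_le _ _
    _ ≤ (ε / 2 : ℝ≥0) * _root_.mconv μ ν (Ioi x) +
          (ε / 2 / C : ℝ≥0) * (C * _root_.mconv μ ν (Ioi x)) := by
        refine add_le_add (prod_large_le hA x) (hsmall.trans ?_)
        gcongr
    _ = ε * _root_.mconv μ ν (Ioi x) := by
        rw [← mul_assoc, ← ENNReal.coe_mul, div_mul_cancel₀ _ hC.ne', ← add_mul,
          ← ENNReal.coe_add, add_halves]

lemma mconv_Ioi_ne_zero {μ ν : Measure ℝ} [NeZero ν] [SFinite ν] (h : ∀ x, μ (Ioi x) ≠ 0)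
    (x : ℝ) : mconv μ ν (Ioi x) ≠ 0 := by
  obtain ⟨M, hM⟩ := exists_nat_measure_Ioc_ne_zero ν
  refine ((pos_iff_ne_zero.2 (mul_ne_zero (h (x + M)) hM)).trans_le
    (mul_le_mconv measurableSet_Ioi fun u hu b hb => ?_)).ne'
  have hu' : x + M < u := hu
  show x < u + b
  linarith [hb.1]

lemma LongTailed.mconv_right {μ ν : Measure ℝ} [IsProbabilityMeasure μ] [IsProbabilityMeasure ν]
    (h : LongTailed μ) {N : ℕ}
    (hν : ∀ ε : ℝ≥0, 0 < ε → ∀ᶠ x in atTop, ν (Ioc x (x + 1)) ≤ ε * μ (Ioi (x - N))) :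
    LongTailed (mconv μ ν) :=
  (h.unitIntervalNegligible.mconv hν).longTailed (mconv_Ioi_ne_zero h.measure_Ioi_ne_zero)

lemma LongTailed.nconv_succ {F : Measure ℝ} [IsProbabilityMeasure F] {n : ℕ} (hn : 1 ≤ n)
    (h : LongTailed (nconv F n)) : LongTailed (nconv F (n + 1)) := by
  obtain ⟨m, rfl⟩ := Nat.exists_eq_add_of_le' hn
  have hneg : UnitIntervalNegligible (mconv (nconv F m) F) := h.unitIntervalNegligible
  obtain ⟨N, hN⟩ := hneg.exists_shift
  exact h.mconv_right hN

/-- If the n-fold convolution of F is long-tailed for some n at least 1, then the k-fold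
convolution is long-tailed for every k at least n. -/
theorem stmt9 (F : Measure ℝ) [IsProbabilityMeasure F] (n : ℕ) (hn : 1 ≤ n)
    (h : LongTailed (nconv F n)) : ∀ k, n ≤ k → LongTailed (nconv F k) := by
  intro k hk
  induction k, hk using Nat.le_induction with
  | base => exact h
  | succ k hk ih => exact ih.nconv_succ (hn.trans hk)
end

section
/- Let α ∈ [1/2, 1), b > 0, t ≥ 1, r = 1 + 1/α, and a > 1 with a^r > 2^{t+2} a; set aₙ = a^{rⁿ} for n ≥ 0. Let η be a random variable with P(η = aₙ) = C aₙ^{-α} where C = (∑_{n≥0} aₙ^{-α})^{-1}, let U be uniform on (0,1) independent of η, and let ξ = η(1 + U^{1/b})^t with distribution F. Then limsup_{x→∞} \bar{F}(x-1)/\bar{F}(x) = b t^{-1} 2^{-t+1} + 1; in particular F is not long-tailed but F belongs to the class OL. -/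
open MeasureTheory Filter Set Asymptotics

/-- The class OL of generalised long-tailed distributions. -/
def OLClass (μ : Measure ℝ) : Prop :=
  (∀ x, 0 < tail μ x) ∧ ∀ c > 0, ∃ M : ℝ, ∀ᶠ x in atTop, tail μ (x - c) ≤ M * tail μ x

/-- The tail of `(1 + U ^ (1 / b)) ^ t` for `U` uniform on `(0, 1)`. -/
noncomputable def baseTail (b t y : ℝ) : ℝ :=
  max (1 - ((max y 1) ^ (1 / t) - 1) ^ b) 0

section BaseTail

variable {b t : ℝ}

theorem baseTail_nonneg (y : ℝ) : 0 ≤ baseTail b t y := le_max_right _ _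

theorem one_le_max_rpow (ht : 0 < t) (y : ℝ) : 1 ≤ (max y 1) ^ (1 / t) :=
  Real.one_le_rpow (le_max_right _ _) (by positivity)

theorem baseTail_le_one (ht : 0 < t) (y : ℝ) : baseTail b t y ≤ 1 := by
  have h : 0 ≤ ((max y 1) ^ (1 / t) - 1) ^ b :=
    Real.rpow_nonneg (sub_nonneg.2 (one_le_max_rpow ht y)) _
  exact max_le (by linarith) zero_le_one

theorem antitone_baseTail (hb : 0 < b) (ht : 0 < t) : Antitone (baseTail b t) := by
  intro x y hxy
  have h1 := one_le_max_rpow ht x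
  have h2 : (max x 1) ^ (1 / t) ≤ (max y 1) ^ (1 / t) :=
    Real.rpow_le_rpow (by positivity) (max_le_max hxy le_rfl) (by positivity)
  have h3 : ((max x 1) ^ (1 / t) - 1) ^ b ≤ ((max y 1) ^ (1 / t) - 1) ^ b :=
    Real.rpow_le_rpow (by linarith) (by linarith) hb.le
  exact max_le_max (by linarith) le_rfl

theorem continuous_baseTail (hb : 0 < b) (ht : 0 < t) : Continuous (baseTail b t) := by
  unfold baseTail
  have h1 : Continuous fun y : ℝ => (max y 1) ^ (1 / t) :=
    (continuous_id.max continuous_const).rpow_const fun _ => Or.inr (by positivity)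
  exact (continuous_const.sub
    ((h1.sub continuous_const).rpow_const fun _ => Or.inr hb.le)).max continuous_const

theorem baseTail_of_le_one (hb : 0 < b) {y : ℝ} (hy : y ≤ 1) : baseTail b t y = 1 := by
  simp [baseTail, max_eq_right hy, Real.zero_rpow hb.ne']

theorem two_rpow_rpow_inv (ht : 0 < t) : ((2 : ℝ) ^ t) ^ (1 / t) = 2 := by
  rw [one_div, Real.rpow_rpow_inv zero_le_two ht.ne']

theorem one_lt_two_rpow (ht : 0 < t) : 1 < (2 : ℝ) ^ t :=
  Real.one_lt_rpow one_lt_two ht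

theorem baseTail_of_le (hb : 0 < b) (ht : 0 < t) {y : ℝ} (hy : 2 ^ t ≤ y) :
    baseTail b t y = 0 := by
  refine le_antisymm ((antitone_baseTail hb ht hy).trans ?_) (baseTail_nonneg y)
  rw [baseTail, max_eq_left (one_lt_two_rpow ht).le, two_rpow_rpow_inv ht]
  norm_num

theorem baseTail_pos (hb : 0 < b) (ht : 0 < t) {y : ℝ} (hy : y < 2 ^ t) :
    0 < baseTail b t y := by
  have h1 := one_le_max_rpow ht y
  have h2 : (max y 1) ^ (1 / t) < 2 := by
    rw [← two_rpow_rpow_inv ht]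
    exact Real.rpow_lt_rpow (by positivity) (max_lt hy (one_lt_two_rpow ht)) (by positivity)
  have h3 : ((max y 1) ^ (1 / t) - 1) ^ b < 1 :=
    Real.rpow_lt_one (by linarith) (by linarith) hb
  exact lt_max_of_lt_left (by linarith)

theorem hasStrictDerivAt_baseTail_inner (ht : 0 < t) :
    HasStrictDerivAt (fun y : ℝ => 1 - ((max y 1) ^ (1 / t) - 1) ^ b)
      (-(b * t⁻¹ * 2 ^ (-t + 1))) (2 ^ t) := by
  have hM := one_lt_two_rpow ht
  have h1 : HasStrictDerivAt (fun y : ℝ => y ^ (1 / t))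
      ((1 / t) * ((2 : ℝ) ^ t) ^ (1 / t - 1)) (2 ^ t) :=
    Real.hasStrictDerivAt_rpow_const_of_ne (by positivity) _
  have h2 : HasStrictDerivAt (fun y : ℝ => 1 - (y ^ (1 / t) - 1) ^ b)
      (-(b * (((2 : ℝ) ^ t) ^ (1 / t) - 1) ^ (b - 1) *
        ((1 / t) * ((2 : ℝ) ^ t) ^ (1 / t - 1)))) (2 ^ t) :=
    HasStrictDerivAt.const_sub 1 <| HasStrictDerivAt.comp (2 ^ t)
      (Real.hasStrictDerivAt_rpow_const_of_ne (by rw [two_rpow_rpow_inv ht]; norm_num) b)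
      (h1.sub_const 1)
  have h3 : (fun y : ℝ => 1 - (y ^ (1 / t) - 1) ^ b) =ᶠ[nhds (2 ^ t)]
      fun y : ℝ => 1 - ((max y 1) ^ (1 / t) - 1) ^ b := by
    filter_upwards [lt_mem_nhds hM] with y hy
    rw [max_eq_left hy.le]
  refine (h2.congr_of_eventuallyEq h3).congr_deriv ?_
  rw [two_rpow_rpow_inv ht, ← Real.rpow_mul zero_le_two,
    show t * (1 / t - 1) = -t + 1 by field_simp; ring]
  norm_num
  ring

theorem exists_baseTail_sub_le_near (hb : 0 < b) (ht : 0 < t) {K : ℝ} (hK : b * t⁻¹ * 2 ^ (-t + 1) < K) :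
    ∃ δ > 0, ∀ x y, x ≤ y → |x - 2 ^ t| < δ → |y - 2 ^ t| < δ →
      baseTail b t x - baseTail b t y ≤ K * (y - x) := by
  have hK0 : 0 < K := lt_trans (by positivity) hK
  have h := (hasStrictDerivAt_baseTail_inner (b := b) ht).isLittleO.bound (sub_pos.2 hK)
  obtain ⟨δ, hδ, h⟩ := Metric.eventually_nhds_iff.1 h
  refine ⟨δ, hδ, fun x y hxy hx hy => ?_⟩
  have h1 := h (y := (x, y)) (by simpa [Prod.dist_eq, Real.dist_eq] using ⟨hx, hy⟩)
  have h2 := (le_abs_self _).trans h1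
  simp only [ContinuousLinearMap.toSpanSingleton_apply, smul_eq_mul, Real.norm_eq_abs,
    abs_of_nonpos (sub_nonpos.2 hxy)] at h2
  have h3 : (1 - ((max x 1) ^ (1 / t) - 1) ^ b) - (1 - ((max y 1) ^ (1 / t) - 1) ^ b) ≤
      K * (y - x) := by linarith
  have h4 := baseTail_nonneg (b := b) (t := t) y
  have h5 : 1 - ((max y 1) ^ (1 / t) - 1) ^ b ≤ baseTail b t y := le_max_left _ _
  have hK' : 0 ≤ K * (y - x) := mul_nonneg hK0.le (sub_nonneg.2 hxy)
  rw [sub_le_iff_le_add]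
  exact max_le (by linarith) (by linarith)

theorem tendsto_baseTail_div (hb : 0 < b) (ht : 0 < t) :
    Tendsto (fun h => baseTail b t (2 ^ t - h) / h) (nhdsWithin 0 (Ioi 0))
      (nhds (b * t⁻¹ * 2 ^ (-t + 1))) := by
  have h1 := (hasStrictDerivAt_baseTail_inner (b := b) ht).hasDerivAt
  rw [← sub_zero ((2 : ℝ) ^ t)] at h1
  have h2 := (h1.comp_const_sub (2 ^ t) 0).tendsto_slope_zero_right
  rw [neg_neg] at h2
  refine h2.congr' ?_
  filter_upwards [self_mem_nhdsWithin] with h (hh : 0 < h)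
  have hpos := baseTail_pos hb ht (by linarith : 2 ^ t - h < 2 ^ t)
  have hval : baseTail b t (2 ^ t - h) = 1 - ((max (2 ^ t - h) 1) ^ (1 / t) - 1) ^ b := by
    refine max_eq_left (le_of_not_gt fun hneg => hpos.ne' (max_eq_right hneg.le))
  rw [hval, sub_zero, zero_add, max_eq_left (one_lt_two_rpow ht).le, two_rpow_rpow_inv ht]
  norm_num [div_eq_inv_mul]

theorem exists_baseTail_sub_le (hb : 0 < b) (ht : 0 < t) {K : ℝ}
    (hK : b * t⁻¹ * 2 ^ (-t + 1) < K) :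
    ∃ h₀ > 0, ∀ h, 0 < h → h < h₀ → ∀ y,
      baseTail b t (y - h) - baseTail b t y ≤ K * (baseTail b t y + h) := by
  have hK0 : 0 < K := lt_trans (by positivity) hK
  have hM := one_lt_two_rpow ht
  obtain ⟨δ, hδ, hnear⟩ := exists_baseTail_sub_le_near hb ht hK
  have hc : 0 < baseTail b t (2 ^ t - δ / 2) := baseTail_pos hb ht (by linarith)
  have huc := isCompact_Icc (a := (0 : ℝ)) (b := 2 ^ t) |>.uniformContinuousOn_of_continuous
    (continuous_baseTail hb ht).continuousOn
  obtain ⟨η, hη, huc⟩ := Metric.uniformContinuousOn_iff.1 huc _ (mul_pos hK0 hc)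
  refine ⟨min (min η 1) (δ / 2), by positivity, fun h h0 hh y => ?_⟩
  obtain ⟨⟨hhη, hh1⟩, hhδ⟩ : (h < η ∧ h < 1) ∧ h < δ / 2 := by simpa using hh
  have hy0 := baseTail_nonneg (b := b) (t := t) y
  have hrhs : 0 ≤ K * (baseTail b t y + h) := by positivity
  rcases le_or_gt y 1 with hy1 | hy1
  · rw [baseTail_of_le_one hb (by linarith : y - h ≤ 1)]
    linarith [baseTail_of_le_one (t := t) hb hy1]
  rcases le_or_gt (2 ^ t + δ / 2) y with hyM | hyM
  · rw [baseTail_of_le hb ht (by linarith : 2 ^ t ≤ y - h)]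
    linarith
  rcases le_or_gt y (2 ^ t - δ / 2) with hyδ | hyδ
  · have h1 := huc (y - h) ⟨by linarith, by linarith⟩ y ⟨by linarith, by linarith⟩
      (by rw [Real.dist_eq, show y - h - y = -h by ring, abs_neg, abs_of_pos h0]; exact hhη)
    rw [Real.dist_eq] at h1
    have h2 := antitone_baseTail hb ht hyδ
    calc _ ≤ _ := (le_abs_self _).trans h1.le
      _ ≤ _ := by gcongr; linarith
  · have h1 := hnear (y - h) y (by linarith) (abs_lt.2 ⟨by linarith, by linarith⟩)
      (abs_lt.2 ⟨by linarith, by linarith⟩)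
    refine h1.trans ?_
    gcongr
    linarith

theorem restrict_setOf_lt_eq (hb : 0 < b) (ht : 0 < t) (y : ℝ) :
    (volume.restrict (Ioo (0 : ℝ) 1)) {u | y < (1 + u ^ (1 / b)) ^ t} =
      ENNReal.ofReal (baseTail b t y) := by
  have h1 := one_le_max_rpow ht y
  have hz : 0 ≤ ((max y 1) ^ (1 / t) - 1) ^ b := Real.rpow_nonneg (by linarith) _
  have hset : {u : ℝ | y < (1 + u ^ (1 / b)) ^ t} ∩ Ioo 0 1 =
      Ioo (((max y 1) ^ (1 / t) - 1) ^ b) 1 := by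
    ext u
    have key : ∀ u : ℝ, 0 < u → (y < (1 + u ^ (1 / b)) ^ t ↔
        ((max y 1) ^ (1 / t) - 1) ^ b < u) := by
      intro u hu
      have hub : 0 < u ^ (1 / b) := Real.rpow_pos_of_pos hu _
      have hgt : 1 < (1 + u ^ (1 / b)) ^ t := Real.one_lt_rpow (by linarith) ht
      calc y < (1 + u ^ (1 / b)) ^ t ↔ max y 1 < (1 + u ^ (1 / b)) ^ t := by
            rw [max_lt_iff, and_iff_left hgt]
        _ ↔ (max y 1) ^ (1 / t) < 1 + u ^ (1 / b) := by
            rw [one_div t, Real.rpow_inv_lt_iff_of_pos (by positivity) (by positivity) ht]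
        _ ↔ (max y 1) ^ (1 / t) - 1 < u ^ (1 / b) := by
            constructor <;> intro h <;> linarith
        _ ↔ _ := by
            rw [one_div b, Real.lt_rpow_inv_iff_of_pos (by linarith) hu.le hb]
    constructor
    · rintro ⟨h, hu⟩
      exact ⟨(key u hu.1).1 h, hu.2⟩
    · rintro ⟨h, hu⟩
      exact ⟨(key u (hz.trans_lt h)).2 h, hz.trans_lt h, hu⟩
  rw [Measure.restrict_apply' measurableSet_Ioo, hset, Real.volume_Ioo, baseTail,
    ENNReal.ofReal_max]
  simp

end BaseTail

theorem tail_map_prod_sum_dirac {b t : ℝ} (hb : 0 < b) (ht : 0 < t) {A p : ℕ → ℝ}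
    (hA : ∀ n, 0 < A n) (hp : ∀ n, 0 ≤ p n) (x : ℝ) :
    tail (Measure.map (fun q : ℝ × ℝ => q.1 * (1 + q.2 ^ (1 / b)) ^ t)
      ((Measure.sum fun n => ENNReal.ofReal (p n) • Measure.dirac (A n)).prod
        (volume.restrict (Ioo (0 : ℝ) 1)))) x = ∑' n, p n * baseTail b t (x / A n) := by
  have hmeas : Measurable fun q : ℝ × ℝ => q.1 * (1 + q.2 ^ (1 / b)) ^ t := by fun_prop
  rw [tail, Measure.map_apply hmeas measurableSet_Ioi,
    Measure.prod_apply (hmeas measurableSet_Ioi), lintegral_sum_measure]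
  simp only [lintegral_smul_measure, lintegral_dirac, smul_eq_mul]
  have hset : ∀ n, (Prod.mk (A n) ⁻¹' ((fun q : ℝ × ℝ => q.1 * (1 + q.2 ^ (1 / b)) ^ t) ⁻¹'
      Ioi x)) = {u | x / A n < (1 + u ^ (1 / b)) ^ t} := by
    intro n
    ext u
    simp [div_lt_iff₀' (hA n)]
  simp only [hset, restrict_setOf_lt_eq hb ht]
  rw [ENNReal.tsum_toReal_eq fun n => ENNReal.mul_ne_top ENNReal.ofReal_ne_top
    ENNReal.ofReal_ne_top]
  simp [hp, baseTail_nonneg]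

/-- A sequence of scales growing at least quadratically, with weights `p (n + 1) = p n / A n`. -/
structure ScaleWeights (A p : ℕ → ℝ) : Prop where
  one_lt : ∀ n, 1 < A n
  sq_le : ∀ n, A n * A n ≤ A (n + 1)
  pos : ∀ n, 0 < p n
  succ : ∀ n, p (n + 1) = p n / A n
  tendsto : Tendsto A atTop atTop

namespace ScaleWeights

variable {A p : ℕ → ℝ} {b t : ℝ}

theorem scale_pos (S : ScaleWeights A p) (n : ℕ) : 0 < A n := zero_lt_one.trans (S.one_lt n)

theorem strictMono (S : ScaleWeights A p) : StrictMono A :=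
  strictMono_nat_of_lt_succ fun n => by nlinarith [S.one_lt n, S.sq_le n]

theorem summable (S : ScaleWeights A p) : Summable p := by
  refine summable_of_ratio_norm_eventually_le (r := (A 0)⁻¹)
    (inv_lt_one_of_one_lt₀ (S.one_lt 0)) (Eventually.of_forall fun n => ?_)
  rw [Real.norm_of_nonneg (S.pos _).le, Real.norm_of_nonneg (S.pos _).le, S.succ,
    div_eq_inv_mul]
  have := S.pos n
  have := S.scale_pos 0
  gcongr
  exact S.strictMono.monotone n.zero_le

theorem summable_mul (S : ScaleWeights A p) (ht : 0 < t) (x : ℝ) :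
    Summable fun n => p n * baseTail b t (x / A n) :=
  S.summable.of_nonneg_of_le (fun n => mul_nonneg (S.pos n).le (baseTail_nonneg _))
    fun n => mul_le_of_le_one_right (S.pos n).le (baseTail_le_one ht _)

theorem tsum_sub_tsum_eq (S : ScaleWeights A p) (hb : 0 < b) (ht : 0 < t) {n : ℕ} {x : ℝ}
    (h1 : ∀ k < n, 2 ^ t * A k ≤ x - 1) (h2 : x ≤ A (n + 1)) :
    ∑' k, p k * baseTail b t ((x - 1) / A k) - ∑' k, p k * baseTail b t (x / A k) =
      p n * (baseTail b t ((x - 1) / A n) - baseTail b t (x / A n)) := by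
  rw [← (S.summable_mul ht _).tsum_sub (S.summable_mul ht _), tsum_eq_single n, mul_sub]
  intro k hk
  have hAk := S.scale_pos k
  rcases hk.lt_or_gt with hk | hk
  · have := h1 k hk
    rw [baseTail_of_le hb ht ((le_div_iff₀ hAk).2 this),
      baseTail_of_le hb ht ((le_div_iff₀ hAk).2 (by linarith))]
    simp
  · have := S.strictMono.monotone (Nat.succ_le_of_lt hk)
    rw [baseTail_of_le_one hb ((div_le_one₀ hAk).2 (by linarith)),
      baseTail_of_le_one hb ((div_le_one₀ hAk).2 (by linarith))]
    simp

theorem le_tsum (S : ScaleWeights A p) (hb : 0 < b) (ht : 0 < t) {n : ℕ} {x : ℝ}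
    (h : x ≤ A (n + 1)) :
    p n * (baseTail b t (x / A n) + 1 / A n) ≤ ∑' k, p k * baseTail b t (x / A k) := by
  have h1 := (S.summable_mul (b := b) ht x).sum_le_tsum {n, n + 1}
    fun k _ => mul_nonneg (S.pos k).le (baseTail_nonneg _)
  rw [Finset.sum_pair (by simp),
    baseTail_of_le_one hb ((div_le_one₀ (S.scale_pos (n + 1))).2 h), S.succ] at h1
  refine le_trans (le_of_eq ?_) h1
  ring

theorem tsum_pos (S : ScaleWeights A p) (hb : 0 < b) (ht : 0 < t) (x : ℝ) :
    0 < ∑' k, p k * baseTail b t (x / A k) := by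
  obtain ⟨n, hn⟩ := ((tendsto_add_atTop_iff_nat 1).2 S.tendsto |>.eventually_ge_atTop x).exists
  have := S.pos n
  have := S.scale_pos n
  have := baseTail_nonneg (b := b) (t := t) (x / A n)
  exact lt_of_lt_of_le (by positivity) (S.le_tsum hb ht hn)

theorem eventually_mul_add_one_le (S : ScaleWeights A p) (M : ℝ) :
    ∀ᶠ n in atTop, M * A n + 1 ≤ A (n + 1) := by
  filter_upwards [S.tendsto.eventually_ge_atTop (M + 1)] with n hn
  nlinarith [S.one_lt n, S.sq_le n]

theorem eventually_tsum_sub_le (S : ScaleWeights A p) (hb : 0 < b) (ht : 0 < t) {K : ℝ}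
    (hK : b * t⁻¹ * 2 ^ (-t + 1) < K) :
    ∀ᶠ x in atTop, ∑' k, p k * baseTail b t ((x - 1) / A k) ≤
      (K + 1) * ∑' k, p k * baseTail b t (x / A k) := by
  have hK0 : 0 < K := lt_trans (by positivity) hK
  obtain ⟨h₀, hh₀, hbound⟩ := exists_baseTail_sub_le hb ht hK
  have hM := one_lt_two_rpow ht
  obtain ⟨N, hN⟩ := eventually_atTop.1 ((S.eventually_mul_add_one_le (2 ^ t)).and
    (S.tendsto.eventually_gt_atTop h₀⁻¹))
  filter_upwards [eventually_ge_atTop (2 ^ t * A N + 1)] with x hx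
  have hex : ∃ n, x < 2 ^ t * A n + 1 := by
    obtain ⟨n, hn⟩ := (S.tendsto.eventually_gt_atTop x).exists
    exact ⟨n, by nlinarith [S.scale_pos n]⟩
  classical
  set n := Nat.find hex
  have hxn : x < 2 ^ t * A n + 1 := Nat.find_spec hex
  have hlt : ∀ k < n, 2 ^ t * A k ≤ x - 1 := fun k hk => by
    linarith [not_lt.1 (Nat.find_min hex hk)]
  have hNn : N ≤ n := by
    by_contra! h
    have := S.strictMono.monotone h.le
    nlinarith
  obtain ⟨hstep, hlarge⟩ := hN n hNn
  have hA := S.scale_pos n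
  have hx1 : x ≤ A (n + 1) := by linarith
  have hh : 1 / A n < h₀ := by
    rw [one_div]
    exact inv_lt_of_inv_lt₀ hh₀ hlarge
  have h1 := S.tsum_sub_tsum_eq hb ht hlt hx1
  have h2 := hbound (1 / A n) (by positivity) hh (x / A n)
  rw [← sub_div] at h2
  have h3 := mul_le_mul_of_nonneg_left h2 (S.pos n).le
  have h4 := mul_le_mul_of_nonneg_left (S.le_tsum hb ht hx1) hK0.le
  linarith

theorem tsum_mul_one_sub_le (S : ScaleWeights A p) (hb : 0 < b) (ht : 0 < t) {n : ℕ}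
    (h : 2 ^ t * A n ≤ A (n + 1)) :
    (∑' k, p k * baseTail b t (2 ^ t * A n / A k)) * (1 - (A (n + 1))⁻¹) ≤ p n / A n := by
  have hsum : ∀ m, Summable fun k => p (k + m) := fun m => (summable_nat_add_iff m).2 S.summable
  have htail : ∑' k, p k * baseTail b t (2 ^ t * A n / A k) = ∑' k, p (k + (n + 1)) := by
    rw [← (S.summable_mul ht _).sum_add_tsum_nat_add (n + 1), Finset.sum_eq_zero, zero_add]
    · refine tsum_congr fun k => ?_
      have : A (n + 1) ≤ A (k + (n + 1)) := S.strictMono.monotone (by omega)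
      rw [baseTail_of_le_one hb ((div_le_one₀ (S.scale_pos _)).2 (by linarith)), mul_one]
    · intro k hk
      have : A k ≤ A n := S.strictMono.monotone (by have := Finset.mem_range.1 hk; omega)
      rw [baseTail_of_le hb ht ((le_div_iff₀ (S.scale_pos k)).2 (by gcongr)), mul_zero]
  have hle : ∑' k, p (k + 1 + (n + 1)) ≤ ∑' k, p (k + (n + 1)) * (A (n + 1))⁻¹ := by
    refine Summable.tsum_le_tsum (fun k => ?_) ((summable_nat_add_iff 1).2 (hsum (n + 1)))
      ((hsum (n + 1)).mul_right _)
    rw [show k + 1 + (n + 1) = k + (n + 1) + 1 by ring, S.succ, div_eq_mul_inv]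
    have := S.pos (k + (n + 1))
    have := S.scale_pos (n + 1)
    gcongr
    exact S.strictMono.monotone (by omega)
  have hsplit := (hsum (n + 1)).tsum_eq_zero_add
  rw [tsum_mul_right] at hle
  rw [zero_add, S.succ] at hsplit
  rw [htail]
  linarith

theorem eventually_le_tsum_div (S : ScaleWeights A p) (hb : 0 < b) (ht : 0 < t) :
    ∀ᶠ n in atTop, baseTail b t (2 ^ t - (A n)⁻¹) / (A n)⁻¹ * (1 - (A (n + 1))⁻¹) + 1 ≤
      (∑' k, p k * baseTail b t ((2 ^ t * A n - 1) / A k)) /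
        ∑' k, p k * baseTail b t (2 ^ t * A n / A k) := by
  have hM := one_lt_two_rpow ht
  have hstep := S.eventually_mul_add_one_le (2 ^ t)
  filter_upwards [hstep, (tendsto_sub_atTop_nat 1).eventually hstep, eventually_ge_atTop 1]
    with n hn hn' hn1
  rw [Nat.sub_add_cancel hn1] at hn'
  have hA := S.scale_pos n
  have hlt : ∀ k < n, 2 ^ t * A k ≤ 2 ^ t * A n - 1 := fun k hk => by
    have : A k ≤ A (n - 1) := S.strictMono.monotone (by omega)
    nlinarith
  have h1 := S.tsum_sub_tsum_eq hb ht hlt (by linarith)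
  rw [mul_div_cancel_right₀ _ hA.ne', baseTail_of_le hb ht le_rfl, sub_zero, sub_div,
    mul_div_cancel_right₀ _ hA.ne', one_div] at h1
  have hT := S.tsum_pos hb ht (2 ^ t * A n)
  have h2 := mul_le_mul_of_nonneg_left (S.tsum_mul_one_sub_le hb ht (by linarith))
    (div_nonneg (baseTail_nonneg (b := b) (t := t) (2 ^ t - (A n)⁻¹)) (inv_pos.2 hA).le)
  have h3 : baseTail b t (2 ^ t - (A n)⁻¹) / (A n)⁻¹ * (p n / A n) =
      p n * baseTail b t (2 ^ t - (A n)⁻¹) := by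
    field_simp
  rw [le_div_iff₀ hT]
  linarith

theorem tendsto_lower_bound (S : ScaleWeights A p) (hb : 0 < b) (ht : 0 < t) :
    Tendsto (fun n => baseTail b t (2 ^ t - (A n)⁻¹) / (A n)⁻¹ * (1 - (A (n + 1))⁻¹) + 1) atTop
      (nhds (b * t⁻¹ * 2 ^ (-t + 1) + 1)) := by
  have h1 : Tendsto (fun n => (A n)⁻¹) atTop (nhdsWithin 0 (Ioi 0)) :=
    tendsto_inv_atTop_nhdsGT_zero.comp S.tendsto
  have h2 : Tendsto (fun n => (A (n + 1))⁻¹) atTop (nhds 0) :=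
    (tendsto_add_atTop_iff_nat 1).2 (tendsto_nhds_of_tendsto_nhdsWithin h1)
  simpa using (((tendsto_baseTail_div hb ht).comp h1).mul (h2.const_sub 1)).add_const 1

theorem limsup_eq (S : ScaleWeights A p) (hb : 0 < b) (ht : 0 < t) :
    atTop.limsup (fun x => (∑' k, p k * baseTail b t ((x - 1) / A k)) /
      ∑' k, p k * baseTail b t (x / A k)) = b * t⁻¹ * 2 ^ (-t + 1) + 1 := by
  set f : ℝ → ℝ := fun x => (∑' k, p k * baseTail b t ((x - 1) / A k)) /
      ∑' k, p k * baseTail b t (x / A k)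
  have hupper : ∀ K, b * t⁻¹ * 2 ^ (-t + 1) < K → ∀ᶠ x in atTop, f x ≤ K + 1 := fun K hK => by
    filter_upwards [S.eventually_tsum_sub_le hb ht hK] with x hx
    exact (div_le_iff₀ (S.tsum_pos hb ht x)).2 hx
  have hpos : ∀ x, 0 ≤ f x := fun x =>
    div_nonneg (S.tsum_pos hb ht _).le (S.tsum_pos hb ht _).le
  have hcob : IsCoboundedUnder (· ≤ ·) atTop f :=
    (isBoundedUnder_of ⟨0, hpos⟩ : IsBoundedUnder (· ≥ ·) atTop f).isCoboundedUnder_le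
  have hbdd : IsBoundedUnder (· ≤ ·) atTop f := ⟨_, hupper _ (lt_add_one _)⟩
  refine le_antisymm (le_of_forall_gt_imp_ge_of_dense fun c hc => ?_)
    (le_of_forall_lt_imp_le_of_dense fun c hc => ?_)
  · refine limsup_le_of_le hcob ?_
    simpa using hupper (c - 1) (by linarith)
  · refine le_limsup_of_frequently_le ?_ hbdd
    have hx : Tendsto (fun n => 2 ^ t * A n) atTop atTop :=
      S.tendsto.const_mul_atTop (by positivity)
    refine hx.frequently (Eventually.frequently ?_)
    filter_upwards [S.eventually_le_tsum_div hb ht,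
      (S.tendsto_lower_bound hb ht).eventually (lt_mem_nhds hc)] with n h1 h2
    exact h2.le.trans h1

end ScaleWeights

theorem scaleWeights_rpow {α r a C : ℝ} (hα : α ∈ Set.Ico (1 / 2 : ℝ) 1) (hr : r = 1 + 1 / α)
    (ha : 1 < a) {A : ℕ → ℝ} (hA : ∀ n, A n = a ^ (r ^ n)) (hC : 0 < C) :
    ScaleWeights A (fun n => C * A n ^ (-α)) := by
  obtain ⟨hα1, hα2⟩ := hα
  have hα0 : 0 < α := by linarith
  have hr2 : 2 ≤ r := by
    rw [hr]
    linarith [(one_le_div hα0).2 hα2.le]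
  have hsucc : ∀ n, A (n + 1) = A n ^ r := fun n => by
    rw [hA, hA, pow_succ, Real.rpow_mul (by linarith)]
  have hone : ∀ n, 1 < A n := fun n => by
    rw [hA]
    exact Real.one_lt_rpow ha (by positivity)
  refine ⟨hone, fun n => ?_, fun n => ?_, fun n => ?_, ?_⟩
  · rw [hsucc, ← sq, ← Real.rpow_two]
    exact Real.rpow_le_rpow_of_exponent_le (hone n).le hr2
  · have := zero_lt_one.trans (hone n)
    positivity
  · have hpos := zero_lt_one.trans (hone n)
    rw [hsucc, ← Real.rpow_mul hpos.le, show r * -α = -α - 1 by rw [hr]; field_simp; ring,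
      Real.rpow_sub_one hpos.ne']
    ring
  · simp only [funext hA]
    exact (tendsto_rpow_atTop_of_base_gt_one a ha).comp
      (tendsto_pow_atTop_atTop_of_one_lt (by linarith))

theorem oLClass_of_eventually_le {μ : Measure ℝ} [IsFiniteMeasure μ] (hpos : ∀ x, 0 < tail μ x)
    {K : ℝ} (hK0 : 0 ≤ K) (hK : ∀ᶠ x in atTop, tail μ (x - 1) ≤ K * tail μ x) : OLClass μ := by
  refine ⟨hpos, fun c _ => ?_⟩
  have hiter : ∀ n : ℕ, ∀ᶠ x in atTop, tail μ (x - n) ≤ K ^ n * tail μ x := by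
    intro n
    induction n with
    | zero => simp
    | succ n ih =>
      filter_upwards [hK, (tendsto_atTop_add_const_right atTop (-1) tendsto_id).eventually ih]
        with x h1 h2
      rw [id, ← sub_eq_add_neg] at h2
      calc tail μ (x - (n + 1 : ℕ)) = tail μ (x - 1 - n) := by push_cast; ring_nf
        _ ≤ K ^ n * tail μ (x - 1) := h2
        _ ≤ K ^ n * (K * tail μ x) := by gcongr
        _ = K ^ (n + 1) * tail μ x := by ring
  obtain ⟨n, hn⟩ := exists_nat_ge c
  refine ⟨K ^ n, ?_⟩
  filter_upwards [hiter n] with x hx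
  refine le_trans ?_ hx
  exact ENNReal.toReal_mono (measure_ne_top _ _)
    (measure_mono (Ioi_subset_Ioi (by linarith)))

theorem LongTailed.tendsto_sub_one {μ : Measure ℝ} (h : LongTailed μ) :
    Tendsto (fun x => tail μ (x - 1) / tail μ x) atTop (nhds 1) := by
  have h1 := (h.comp (tendsto_atTop_add_const_right atTop (-1) tendsto_id)).inv₀ one_ne_zero
  simpa [Function.comp_def, ← sub_eq_add_neg] using h1

/-- For the family F₁(0): ξ = η (1 + U^{1/b})^t, the limsup of tail F (x-1) / tail F x
equals b t⁻¹ 2^{-t+1} + 1; in particular F is not long-tailed, but F is in OL. -/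
theorem stmt14 (α b t r a : ℝ) (hα : α ∈ Set.Ico (1/2 : ℝ) 1) (hb : 0 < b) (ht : 1 ≤ t)
    (hr : r = 1 + 1/α) (ha : 1 < a) (ha2 : 2 ^ (t + 2) * a < a ^ r)
    (aseq : ℕ → ℝ) (haseq : ∀ n, aseq n = a ^ (r ^ n))
    (C : ℝ) (hC : C = (∑' n : ℕ, aseq n ^ (-α))⁻¹)
    (ηlaw : Measure ℝ)
    (hη : ηlaw = Measure.sum
      (fun n => ENNReal.ofReal (C * aseq n ^ (-α)) • Measure.dirac (aseq n)))
    (Ulaw : Measure ℝ) (hU : Ulaw = MeasureTheory.volume.restrict (Set.Ioo (0:ℝ) 1))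
    (F : Measure ℝ)
    (hF : F = Measure.map (fun q : ℝ × ℝ => q.1 * (1 + q.2 ^ (1/b)) ^ t)
      (ηlaw.prod Ulaw)) :
    atTop.limsup (fun x => tail F (x - 1) / tail F x) = b * t⁻¹ * 2 ^ (-t + 1) + 1 ∧
      ¬ LongTailed F ∧ OLClass F := by
  have ht0 : 0 < t := by linarith
  have hC0 : 0 < C := by
    have S := scaleWeights_rpow hα hr ha haseq one_pos
    have hsum : Summable fun n => aseq n ^ (-α) := by simpa using S.summable
    rw [hC]
    exact inv_pos.2 (hsum.tsum_pos (fun n => by simpa using (S.pos n).le) 0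
      (by simpa using S.pos 0))
  have S := scaleWeights_rpow hα hr ha haseq hC0
  have htail : ∀ x, tail F x = ∑' n, C * aseq n ^ (-α) * baseTail b t (x / aseq n) := fun x => by
    rw [hF, hη, hU]
    exact tail_map_prod_sum_dirac hb ht0 S.scale_pos (fun n => (S.pos n).le) x
  have hpos : ∀ x, 0 < tail F x := fun x => by
    rw [htail]
    exact S.tsum_pos hb ht0 x
  have hlim : atTop.limsup (fun x => tail F (x - 1) / tail F x) =
      b * t⁻¹ * 2 ^ (-t + 1) + 1 := by
    simp only [htail]
    exact S.limsup_eq hb ht0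
  have hL : 0 < b * t⁻¹ * 2 ^ (-t + 1) := by positivity
  refine ⟨hlim, fun hlong => ?_, ?_⟩
  · rw [hlong.tendsto_sub_one.limsup_eq] at hlim
    linarith
  · have hbound := S.eventually_tsum_sub_le hb ht0 (lt_add_one (b * t⁻¹ * 2 ^ (-t + 1)))
    simp only [← htail] at hbound
    have hfin : IsFiniteMeasure F := by
      have : IsFiniteMeasure ηlaw := by
        refine ⟨?_⟩
        rw [hη, Measure.sum_apply _ MeasurableSet.univ]
        simpa using S.summable.tsum_ofReal_lt_top
      rw [hF, hU]
      infer_instance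
    exact oLClass_of_eventually_le hpos (by positivity) hbound
end
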